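/- arXiv:1705.02954 — 2 statements merged into one kernel-verified Lean document; each statement's English description precedes it below -/
import Mathlib

section
/- For any group G, the set sFAut(G) of strongly finitary automorphisms of G is a subgroup of Aut(G); this subgroup is locally finite (every finitely generated subgroup of it is finite), and it coincides with the set of elements of finite order of the group FAut(G) of finitary automorphisms of G. -/
/-- The subgroup of fixed points of an automorphism `γ` of `G`. -/
def FixedSubgroup {G : Type*} [Group G] (γ : G ≃* G) : Subgroup G where
  carrier := {x : G | γ x = x}
  one_mem' := map_one γ
  mul_mem' := by
    intro a b ha hb
    simp only [Set.mem_setOf_eq] at *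
    rw [map_mul, ha, hb]
  inv_mem' := by
    intro a ha
    simp only [Set.mem_setOf_eq] at *
    rw [map_inv, ha]

/-- An automorphism `γ` of `G` is finitary if its fixed-point subgroup has finite
index in `G`. -/
def FinitaryAut {G : Type*} [Group G] (γ : G ≃* G) : Prop :=
  (FixedSubgroup γ).FiniteIndex

/-- An automorphism `γ` of `G` is strongly finitary if there is a finite
`γ`-invariant normal subgroup `N` of `G` such that `γ` induces the identity on `G/N`. -/
def StronglyFinitaryAut {G : Type*} [Group G] (γ : G ≃* G) : Prop :=
  ∃ N : Subgroup G, Finite N ∧ N.Normal ∧ N.map γ.toMonoidHom = N ∧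
    ∀ x : G, γ x * x⁻¹ ∈ N

theorem finite_sup_of_normal {G : Type*} [Group G] (M N : Subgroup G) [N.Normal] [Finite M]
    [Finite N] : Finite (M ⊔ N : Subgroup G) := by
  have h : ((M ⊔ N : Subgroup G) : Set G).Finite := by
    rw [Subgroup.mul_normal]
    exact (Set.toFinite (M : Set G)).mul (Set.toFinite (N : Set G))
  exact h.to_subtype

/-- Displacements `γ x * x⁻¹` lying in a finite normal subgroup already make `γ` strongly
finitary: the invariance of the subgroup is automatic. -/
theorem stronglyFinitaryAut_iff {G : Type*} [Group G] (γ : G ≃* G) :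
    StronglyFinitaryAut γ ↔
      ∃ N : Subgroup G, Finite N ∧ N.Normal ∧ ∀ x : G, γ x * x⁻¹ ∈ N := by
  refine ⟨fun ⟨N, hf, hn, _, h⟩ => ⟨N, hf, hn, h⟩, fun ⟨N, hf, hn, h⟩ => ⟨N, hf, hn, ?_, h⟩⟩
  have hmem (x : G) : γ x ∈ N ↔ x ∈ N := by
    have : γ x = γ x * x⁻¹ * x := by group
    rw [this]
    exact N.mul_mem_cancel_left (h x)
  ext y
  constructor
  · rintro ⟨x, hx, rfl⟩
    exact (hmem x).2 hx
  · intro hy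
    refine ⟨γ.symm y, (hmem _).1 ?_, γ.apply_symm_apply y⟩
    rwa [γ.apply_symm_apply]

/-- The automorphisms of `G` inducing the identity on `G / N`. -/
def autCentralizingQuotient {G : Type*} [Group G] (N : Subgroup G) [N.Normal] :
    Subgroup (MulAut G) where
  carrier := {γ | ∀ x : G, γ x * x⁻¹ ∈ N}
  one_mem' x := by simp
  mul_mem' {γ δ} hγ hδ x := by
    have : (γ * δ) x * x⁻¹ = γ (δ x) * (δ x)⁻¹ * (δ x * x⁻¹) := by
      rw [MulAut.mul_apply]; group
    rw [this]
    exact N.mul_mem (hγ _) (hδ _)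
  inv_mem' {γ} hγ x := by
    have := N.inv_mem (hγ (γ⁻¹ x))
    simpa using this

theorem autCentralizingQuotient_mono {G : Type*} [Group G] {M N : Subgroup G} [M.Normal]
    [N.Normal] (h : M ≤ N) : autCentralizingQuotient M ≤ autCentralizingQuotient N :=
  fun _ hγ x => h (hγ x)

/-- The subgroup of strongly finitary automorphisms. -/
def stronglyFinitarySubgroup (G : Type*) [Group G] : Subgroup (MulAut G) where
  carrier := {γ | StronglyFinitaryAut γ}
  one_mem' := (stronglyFinitaryAut_iff _).2 ⟨⊥, inferInstance, inferInstance, fun x => by simp⟩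
  mul_mem' {γ δ} hγ hδ := by
    obtain ⟨M, _, _, hM⟩ := (stronglyFinitaryAut_iff _).1 hγ
    obtain ⟨N, _, _, hN⟩ := (stronglyFinitaryAut_iff _).1 hδ
    refine (stronglyFinitaryAut_iff _).2 ⟨M ⊔ N, finite_sup_of_normal M N, inferInstance, ?_⟩
    exact mul_mem (autCentralizingQuotient_mono (le_sup_left : M ≤ M ⊔ N) hM)
      (autCentralizingQuotient_mono (le_sup_right : N ≤ M ⊔ N) hN)
  inv_mem' {γ} hγ := by
    obtain ⟨N, hf, _, hN⟩ := (stronglyFinitaryAut_iff _).1 hγ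
    exact (stronglyFinitaryAut_iff _).2
      ⟨N, hf, inferInstance, (autCentralizingQuotient N).inv_mem hN⟩

theorem StronglyFinitaryAut.finitaryAut {G : Type*} [Group G] {γ : G ≃* G}
    (h : StronglyFinitaryAut γ) : FinitaryAut γ := by
  obtain ⟨N, _, _, -, hN⟩ := h
  have : Finite (G ⧸ FixedSubgroup γ) := by
    refine Finite.of_injective (β := N)
      (fun q => Quotient.liftOn' q (fun x => ⟨γ x * x⁻¹, hN x⟩) ?_) ?_
    · intro x y hxy
      have hxy : γ (x⁻¹ * y) = x⁻¹ * y := QuotientGroup.leftRel_apply.1 hxy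
      obtain ⟨c, rfl⟩ : ∃ c, y = x * c := ⟨x⁻¹ * y, by group⟩
      have hc : γ c = c := by simpa using hxy
      simp [hc]
    · intro p q
      induction p using QuotientGroup.induction_on with | H x => ?_
      induction q using QuotientGroup.induction_on with | H y => ?_
      intro hxy
      have hxy : γ x * x⁻¹ = γ y * y⁻¹ := congrArg Subtype.val hxy
      refine QuotientGroup.eq.2 (show γ (x⁻¹ * y) = x⁻¹ * y from ?_)
      have hx : γ x = γ y * y⁻¹ * x := by rw [← hxy]; group
      rw [map_mul, map_inv, hx]
      group
  exact Subgroup.finiteIndex_of_finite_quotient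

/-- A group of automorphisms centralizing `G / N` and fixing pointwise a subgroup of finite
index is finite when `N` is. -/
theorem finite_of_le_autCentralizingQuotient {G : Type*} [Group G] (N : Subgroup G) [N.Normal]
    [Finite N] (C : Subgroup G) [C.FiniteIndex] (T : Subgroup (MulAut G))
    (hT : T ≤ autCentralizingQuotient N) (hC : ∀ t ∈ T, ∀ c ∈ C, t c = c) : Finite T := by
  refine Finite.of_injective (β := G ⧸ C → N)
    (fun t q => ⟨t.1 q.out * (q.out)⁻¹, hT t.2 _⟩) ?_
  intro s t hst
  refine Subtype.ext (MulEquiv.ext fun x => ?_)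
  have hq : s.1 (x : G ⧸ C).out = t.1 (x : G ⧸ C).out :=
    mul_right_cancel (congrArg Subtype.val (congrFun hst (x : G ⧸ C)))
  have hc : (x : G ⧸ C).out⁻¹ * x ∈ C := QuotientGroup.eq.1 (QuotientGroup.out_eq' _)
  have hx : x = (x : G ⧸ C).out * ((x : G ⧸ C).out⁻¹ * x) := by group
  rw [hx, map_mul s.1, map_mul t.1, hC _ s.2 _ hc, hC _ t.2 _ hc, hq]

theorem finite_of_le_stronglyFinitarySubgroup {G : Type*} [Group G] (T : Subgroup (MulAut G))
    (hT : T ≤ stronglyFinitarySubgroup G) (hfg : T.FG) : Finite T := by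
  obtain ⟨F, rfl⟩ := hfg
  have key : ∀ F : Finset (MulAut G), (∀ γ ∈ F, StronglyFinitaryAut γ) →
      ∃ N C : Subgroup G, Finite N ∧ C.FiniteIndex ∧ ∃ _ : N.Normal,
        ∀ γ ∈ F, γ ∈ autCentralizingQuotient N ∧ ∀ c ∈ C, γ c = c := by
    classical
    intro F
    induction F using Finset.induction_on with
    | empty => exact fun _ => ⟨⊥, ⊤, inferInstance, inferInstance, inferInstance, by simp⟩
    | insert δ F _ ih =>
      intro h
      obtain ⟨N, C, _, _, _, hNC⟩ := ih fun γ hγ => h γ (Finset.mem_insert_of_mem hγ)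
      have hδ := h δ (Finset.mem_insert_self _ _)
      have : (FixedSubgroup δ).FiniteIndex := hδ.finitaryAut
      obtain ⟨M, _, _, hM⟩ := (stronglyFinitaryAut_iff _).1 hδ
      refine ⟨M ⊔ N, FixedSubgroup δ ⊓ C, finite_sup_of_normal M N, inferInstance,
        inferInstance, fun γ hγ => ?_⟩
      obtain rfl | hγ := Finset.mem_insert.1 hγ
      · exact ⟨autCentralizingQuotient_mono (le_sup_left : M ≤ M ⊔ N) hM, fun c hc => hc.1⟩
      · exact ⟨autCentralizingQuotient_mono (le_sup_right : N ≤ M ⊔ N) (hNC γ hγ).1,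
          fun c hc => (hNC γ hγ).2 c hc.2⟩
  obtain ⟨N, C, _, _, _, h⟩ := key F fun γ hγ => hT (Subgroup.subset_closure hγ)
  refine finite_of_le_autCentralizingQuotient N C _
    ((Subgroup.closure_le _).2 fun γ hγ => (h γ hγ).1) fun t ht => ?_
  induction ht using Subgroup.closure_induction with
  | mem γ hγ => exact (h γ hγ).2
  | one => exact fun _ _ => rfl
  | mul s t _ _ hs ht => exact fun c hc => by rw [MulAut.mul_apply, ht c hc, hs c hc]
  | inv s _ hs => exact fun c hc => by rw [MulAut.inv_apply, MulEquiv.symm_apply_eq, hs c hc]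

theorem StronglyFinitaryAut.isOfFinOrder {G : Type*} [Group G] {γ : MulAut G}
    (h : StronglyFinitaryAut γ) : IsOfFinOrder γ := by
  have := finite_of_le_stronglyFinitarySubgroup (Subgroup.zpowers γ)
    (Subgroup.zpowers_le.2 h) ⟨{γ}, by simp [Subgroup.zpowers_eq_closure]⟩
  exact finite_zpowers.1 (Set.toFinite (Subgroup.zpowers γ : Set (MulAut G)))

open scoped IsMulCommutative in
/-- A finitely generated torsion group whose center has finite index is finite. -/
theorem finite_of_fg_of_finiteIndex_center {H : Type*} [Group H] [Group.FG H]
    [(Subgroup.center H).FiniteIndex] (ht : IsMulTorsion H) : Finite H := by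
  have : Finite (Subgroup.center H) := CommGroup.finite_of_fg_isMulTorsion _ (ht.subgroup _)
  exact Finite.of_subgroup_quotient (Subgroup.center H)

/-- The subgroup `[G, γ]` generated by the elements `x⁻¹ * γ x`. -/
def displacementSubgroup {G : Type*} [Group G] (γ : G ≃* G) : Subgroup G :=
  Subgroup.closure (Set.range fun x : G => x⁻¹ * γ x)

section displacement

variable {G : Type*} [Group G] (γ : G ≃* G)

theorem inv_mul_apply_mem_displacementSubgroup (x : G) : x⁻¹ * γ x ∈ displacementSubgroup γ :=
  Subgroup.subset_closure ⟨x, rfl⟩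

theorem apply_mem_displacementSubgroup {x : G} (hx : x ∈ displacementSubgroup γ) :
    γ x ∈ displacementSubgroup γ := by
  have : γ x = x * (x⁻¹ * γ x) := by group
  rw [this]
  exact mul_mem hx (inv_mul_apply_mem_displacementSubgroup γ x)

instance displacementSubgroup_normal : (displacementSubgroup γ).Normal := by
  refine ⟨fun n hn g => ?_⟩
  induction hn using Subgroup.closure_induction with
  | mem n hn =>
    obtain ⟨x, rfl⟩ := hn
    have : g * (x⁻¹ * γ x) * g⁻¹ =
        ((x * g⁻¹)⁻¹ * γ (x * g⁻¹)) * ((g⁻¹)⁻¹ * γ g⁻¹)⁻¹ := by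
      rw [map_mul]; group
    show g * (x⁻¹ * γ x) * g⁻¹ ∈ _
    rw [this]
    exact mul_mem (inv_mul_apply_mem_displacementSubgroup γ _)
      (inv_mem (inv_mul_apply_mem_displacementSubgroup γ _))
  | one => simp
  | mul a b _ _ ha hb => simpa [mul_assoc] using mul_mem ha hb
  | inv a _ ha => simpa [mul_assoc] using inv_mem ha

theorem displacementSubgroup_fg [(FixedSubgroup γ).FiniteIndex] :
    (displacementSubgroup γ).FG := by
  have hfin : (Set.range fun x : G => x⁻¹ * γ x).Finite := by
    refine (Set.finite_range fun q : G ⧸ FixedSubgroup γ => q.out * γ q.out⁻¹).subset ?_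
    rintro _ ⟨x, rfl⟩
    refine ⟨(x⁻¹ : G), ?_⟩
    have hc : γ (((x⁻¹ : G) : G ⧸ FixedSubgroup γ).out⁻¹ * x⁻¹) =
        ((x⁻¹ : G) : G ⧸ FixedSubgroup γ).out⁻¹ * x⁻¹ :=
      (QuotientGroup.eq (s := FixedSubgroup γ)).1 (QuotientGroup.out_eq' _)
    have hy := congrArg (· * γ x) hc
    simp only [map_mul, map_inv, inv_mul_cancel_right] at hy
    simp only [map_inv]
    rw [hy]
    group
  exact ⟨hfin.toFinset, by simp [displacementSubgroup]⟩

theorem displacementSubgroup_le_centralizer :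
    displacementSubgroup γ ≤ Subgroup.centralizer ((FixedSubgroup γ).normalCore : Set G) := by
  refine (Subgroup.closure_le _).2 ?_
  rintro _ ⟨x, rfl⟩
  refine Subgroup.mem_centralizer_iff.2 fun d hd => ?_
  have hd' : γ d = d := (FixedSubgroup γ).normalCore_le hd
  have hxd : γ (x * d * x⁻¹) = x * d * x⁻¹ :=
    (FixedSubgroup γ).normalCore_le ((FixedSubgroup γ).normalCore_normal.conj_mem d hd x)
  rw [map_mul, map_mul, map_inv, hd', mul_inv_eq_iff_eq_mul] at hxd
  rw [mul_assoc, hxd]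
  group

theorem finiteIndex_center_displacementSubgroup [(FixedSubgroup γ).FiniteIndex] :
    (Subgroup.center (displacementSubgroup γ)).FiniteIndex := by
  refine Subgroup.finiteIndex_of_le
    (H := (FixedSubgroup γ).normalCore.subgroupOf (displacementSubgroup γ)) fun d hd => ?_
  refine Subgroup.mem_center_iff.2 fun n => Subtype.ext ?_
  exact (Subgroup.mem_centralizer_iff.1 (displacementSubgroup_le_centralizer γ n.2) d.1 hd).symm

open scoped IsMulCommutative in
/-- If `γ` is finitary of finite order then `[G, γ]` is finite. The power map with a suitable
exponent is a homomorphism on `[G, γ]` (it factors through the transfer to the center) with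
values fixed by `γ`, so it sends `x⁻¹ * γ x` to an element of finite order. -/
theorem finite_displacementSubgroup {γ : MulAut G} (hfin : FinitaryAut γ)
    (hord : IsOfFinOrder γ) : Finite (displacementSubgroup γ) := by
  have : (FixedSubgroup γ).FiniteIndex := hfin
  have := finiteIndex_center_displacementSubgroup γ
  have : Group.FG (displacementSubgroup γ) :=
    (Group.fg_iff_subgroup_fg _).2 (displacementSubgroup_fg γ)
  set N := displacementSubgroup γ
  set m := (Subgroup.center N).index
  set k := (FixedSubgroup γ).normalCore.index
  obtain ⟨n, hn, hγn⟩ := isOfFinOrder_iff_pow_eq_one.1 hord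
  have hmul {a b : G} (ha : a ∈ N) (hb : b ∈ N) :
      (a * b) ^ (m * k) = a ^ (m * k) * b ^ (m * k) := by
    have h := map_mul (MonoidHom.transferCenterPow N ^ k) ⟨a, ha⟩ ⟨b, hb⟩
    simpa [Subtype.ext_iff, pow_mul] using h
  have hfix (a : G) : γ (a ^ (m * k)) = a ^ (m * k) := by
    refine (FixedSubgroup γ).normalCore_le ?_
    rw [mul_comm, pow_mul]
    exact pow_mem (Subgroup.pow_index_mem _ a) m
  have hiter (x : G) (j : ℕ) : x⁻¹ * (γ ^ j) x ∈ N ∧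
      (x⁻¹ * (γ ^ j) x) ^ (m * k) = (x⁻¹ * γ x) ^ (m * k * j) := by
    induction j with
    | zero => simp
    | succ j ih =>
      have hstep : x⁻¹ * (γ ^ (j + 1)) x = (x⁻¹ * γ x) * γ (x⁻¹ * (γ ^ j) x) := by
        rw [pow_succ', MulAut.mul_apply, map_mul, map_inv]; group
      have h1 := inv_mul_apply_mem_displacementSubgroup γ x
      have h2 := apply_mem_displacementSubgroup γ ih.1
      rw [hstep]
      refine ⟨mul_mem h1 h2, ?_⟩
      rw [hmul h1 h2, ← map_pow, hfix, ih.2, ← pow_add]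
      congr 1
      ring
  have hexp (a : G) (ha : a ∈ N) : a ^ (m * k * n) = 1 := by
    induction ha using Subgroup.closure_induction with
    | mem a ha =>
      obtain ⟨x, rfl⟩ := ha
      have h := (hiter x n).2
      rw [hγn] at h
      simpa using h.symm
    | one => simp
    | mul a b ha hb iha ihb =>
      have hcomm : Commute (a ^ (m * k)) (b ^ (m * k)) := by
        have h := mul_comm ((MonoidHom.transferCenterPow N ^ k) ⟨a, ha⟩)
          ((MonoidHom.transferCenterPow N ^ k) ⟨b, hb⟩)
        simpa [Subtype.ext_iff, pow_mul, commute_iff_eq] using h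
      rw [pow_mul, hmul ha hb, hcomm.mul_pow, ← pow_mul, ← pow_mul, iha, ihb, one_mul]
    | inv a _ iha => rw [inv_pow, iha, inv_one]
  refine finite_of_fg_of_finiteIndex_center fun a => isOfFinOrder_iff_pow_eq_one.2
    ⟨m * k * n, ?_, Subtype.ext (hexp a a.2)⟩
  have hm0 : m ≠ 0 := Subgroup.FiniteIndex.index_ne_zero
  have hk0 : k ≠ 0 := Subgroup.FiniteIndex.index_ne_zero
  positivity

end displacement

theorem FinitaryAut.stronglyFinitaryAut {G : Type*} [Group G] {γ : MulAut G}
    (hfin : FinitaryAut γ) (hord : IsOfFinOrder γ) : StronglyFinitaryAut γ := by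
  refine (stronglyFinitaryAut_iff _).2 ⟨displacementSubgroup γ,
    finite_displacementSubgroup hfin hord, inferInstance, fun x => ?_⟩
  exact (displacementSubgroup_normal γ).mem_comm (inv_mul_apply_mem_displacementSubgroup γ x)

/-- The strongly finitary automorphisms of any group `G` form a subgroup of `Aut(G)`;
this subgroup is locally finite, and it coincides with the set of elements of finite
order of the group of finitary automorphisms. -/
theorem stmt8 {G : Type*} [Group G] :
    ∃ S : Subgroup (MulAut G),
      (∀ γ : MulAut G, γ ∈ S ↔ StronglyFinitaryAut γ) ∧
      (∀ T : Subgroup (MulAut G), T ≤ S → T.FG → Finite T) ∧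
      (∀ γ : MulAut G, StronglyFinitaryAut γ ↔ (FinitaryAut γ ∧ IsOfFinOrder γ)) := by
  refine ⟨stronglyFinitarySubgroup G, fun _ => Iff.rfl, finite_of_le_stronglyFinitarySubgroup,
    fun γ => ⟨fun h => ⟨h.finitaryAut, h.isOfFinOrder⟩, fun h => h.1.stronglyFinitaryAut h.2⟩⟩
end

section
/- Let V be an infinite-dimensional vector space over a field K and let β be a linear endomorphism of V. Then every linear subspace H of V has finite codimension in H + β(H) (that is, the quotient space (H + β(H))/H is finite-dimensional for every subspace H) if and only if there exist a scalar λ ∈ K and a subspace W of V of finite codimension such that β(w) = λ·w for all w ∈ W. -/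
open Submodule in
/-- If every vector outside a finite-dimensional subspace `F` is an eigenvector of `β` modulo `F`,
then `β` is a scalar modulo `F`. -/
theorem exists_range_sub_smul_le_of_forall_mem_sup_span {K V : Type*} [Field K] [AddCommGroup V]
    [Module K V] (hV : ¬ FiniteDimensional K V) (β : V →ₗ[K] V) (F : Submodule K V)
    [FiniteDimensional K F] (h : ∀ x ∉ F, β x ∈ F ⊔ span K {x}) :
    ∃ a : K, LinearMap.range (β - a • 1) ≤ F := by
  have hcol : ∀ x ∉ F, ∃ a : K, β x - a • x ∈ F := by
    intro x hx
    obtain ⟨f, hf, y, hy, hfy⟩ := mem_sup.1 (h x hx)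
    obtain ⟨a, rfl⟩ := mem_span_singleton.1 hy
    exact ⟨a, by simpa [← hfy] using hf⟩
  have hinv : F ≤ F.comap β := by
    intro x hx
    by_contra hβx
    rw [mem_comap] at hβx
    obtain ⟨y, hy⟩ : ∃ y, y ∉ F ⊔ span K {β x} := by
      by_contra! hall
      have htop : F ⊔ span K {β x} = ⊤ := eq_top_iff'.2 hall
      exact hV (Module.finite_def.2 (htop ▸ (Module.Finite.iff_fg.1 inferInstance)))
    have hyF : y ∉ F := fun hF => hy (mem_sup_left hF)
    obtain ⟨a, ha⟩ := hcol y hyF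
    obtain ⟨b, hb⟩ := hcol (x + y) fun hF => hyF ((F.add_mem_iff_right hx).1 hF)
    have hab : β x - (b - a) • y ∈ F := by
      convert F.add_mem (F.sub_mem hb ha) (F.smul_mem b hx) using 1
      rw [map_add]
      module
    have hne : b - a ≠ 0 := fun h0 => hβx (by simpa [h0] using hab)
    apply hy
    have hmem : (b - a) • y ∈ F ⊔ span K {β x} := by
      rw [← sub_sub_self (β x) ((b - a) • y)]
      exact sub_mem (mem_sup_right (mem_span_singleton_self _)) (mem_sup_left hab)
    exact (smul_mem_iff _ hne).1 hmem
  obtain ⟨a, ha⟩ : ∃ a : K, F.mapQ F β hinv = a • 1 := by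
    apply LinearMap.exists_eq_smul_id_of_forall_notLinearIndependent
    intro q hq
    obtain ⟨x, rfl⟩ := F.mkQ_surjective q
    have hx : x ∉ F := by
      simpa using hq.ne_zero 0
    obtain ⟨a, ha⟩ := hcol x hx
    refine (LinearIndependent.pair_iff' (by simpa using hx)).1 hq a ?_
    rw [← map_smul, eq_comm, ← sub_eq_zero]
    exact (Quotient.mk_eq_zero F).2 ha
  refine ⟨a, ?_⟩
  rintro _ ⟨x, rfl⟩
  have hx := LinearMap.congr_fun ha (F.mkQ x)
  rw [← sub_eq_zero] at hx
  simpa [← Quotient.mk_smul, ← Quotient.mk_sub] using hx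

open Submodule in
/-- If outside each finite-dimensional subspace `F` some `x` has `x`, `β x` independent modulo `F`,
then there is an infinite set `s` such that `s` and its `β`-image are jointly independent. -/
theorem exists_infinite_linearIndependent_sumElim {K V : Type*} [Field K] [AddCommGroup V]
    [Module K V] (β : V →ₗ[K] V)
    (h : ∀ F : Submodule K V, FiniteDimensional K F → ∃ x ∉ F, β x ∉ F ⊔ span K {x}) :
    ∃ s : Set V, s.Infinite ∧
      LinearIndependent K (Sum.elim (fun x : s => (x : V)) fun x : s => β x) := by
  obtain ⟨s, hs⟩ := zorn_subset
    {s : Set V | LinearIndepOn K (Sum.elim id β) (Sum.elim id id ⁻¹' s)} fun c hc hchain =>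
      ⟨⋃₀ c, by
        rw [Set.mem_ofPred_eq, Set.sUnion_eq_biUnion, Set.preimage_iUnion₂]
        refine linearIndepOn_biUnion_of_directed ?_ hc
        exact hchain.directedOn.mono fun _ _ hst => Set.preimage_mono hst,
        fun _ => Set.subset_sUnion_of_mem⟩
  have hli : LinearIndepOn K (Sum.elim id β) (Sum.elim id id ⁻¹' s) := hs.prop
  refine ⟨s, fun hfin => ?_, ?_⟩
  · set T : Set (V ⊕ V) := Sum.elim id id ⁻¹' s with hT
    have hTfin : T.Finite := by
      refine ((hfin.image Sum.inl).union (hfin.image Sum.inr)).subset ?_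
      rintro (x | x) hx <;> simpa [hT] using hx
    obtain ⟨x, hx, hβx⟩ := h (span K (Sum.elim id β '' T))
      (FiniteDimensional.span_of_finite K (hTfin.image _))
    have hins : Sum.elim id id ⁻¹' (insert x s) = insert (Sum.inr x) (insert (Sum.inl x) T) := by
      ext (y | y) <;> simp [hT]
    have hli' : LinearIndepOn K (Sum.elim id β) (Sum.elim id id ⁻¹' (insert x s)) := by
      rw [hins]
      refine (hli.insert (x := Sum.inl x) (by simpa using hx)).insert ?_
      rwa [Set.image_insert_eq, span_insert, sup_comm]
    have hxs : x ∈ s := hs.le_of_ge hli' (Set.subset_insert x s) (Set.mem_insert x s)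
    exact hx (subset_span ⟨Sum.inl x, hxs, rfl⟩)
  · let e : s ⊕ s → ↥(Sum.elim id id ⁻¹' s : Set (V ⊕ V)) :=
      Sum.elim (fun x => ⟨Sum.inl x, x.2⟩) fun x => ⟨Sum.inr x, x.2⟩
    have he : Function.Injective e := by
      rintro (x | x) (y | y) hxy <;> simp_all [e, Subtype.ext_iff]
    convert hli.linearIndependent.comp e he using 1
    ext (x | x) <;> rfl

/-- The inclusion of `L ⧸ H` (for the part of `H` in `L`) into `V ⧸ H` is injective. -/
theorem Submodule.mapQ_subtype_comap_injective {R M : Type*} [Ring R] [AddCommGroup M] [Module R M]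
    (H L : Submodule R M) :
    Function.Injective ((H.comap L.subtype).mapQ H L.subtype le_rfl) := by
  rw [← LinearMap.ker_eq_bot, Submodule.ker_mapQ, Submodule.mkQ_map_self]

open Submodule in
/-- If `s` and its `β`-image are jointly independent and `s` is infinite, then `span s` has infinite
codimension in `span s + β (span s)`. -/
theorem not_finiteDimensional_quotient_of_linearIndependent_sumElim {K V : Type*} [Field K]
    [AddCommGroup V] [Module K V] (β : V →ₗ[K] V) {s : Set V} (hs : s.Infinite)
    (hli : LinearIndependent K (Sum.elim (fun x : s => (x : V)) fun x : s => β x)) :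
    ¬ FiniteDimensional K (↥(span K s ⊔ (span K s).map β) ⧸
      (span K s).comap (span K s ⊔ (span K s).map β).subtype) := by
  intro hfin
  obtain ⟨-, hβ, hdisj⟩ := linearIndependent_sum.1 hli
  simp only [Sum.elim_comp_inl, Sum.elim_comp_inr, Subtype.range_coe] at hβ hdisj
  have hquot : LinearIndependent K ((span K s).mkQ ∘ fun x : s => β x) :=
    hβ.map (by simpa using hdisj.symm)
  set L := span K s ⊔ (span K s).map β
  let w : s → L ⧸ (span K s).comap L.subtype :=
    fun x => mkQ _ ⟨β x, mem_sup_right (mem_map_of_mem (subset_span x.2))⟩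
  have hw : LinearIndependent K w :=
    LinearIndependent.of_comp (((span K s).comap L.subtype).mapQ (span K s) L.subtype le_rfl) hquot
  exact hs (Set.finite_coe_iff.1 hw.finite_of_isNoetherian)

open Submodule in
/-- If `β - a` has finite rank, then every subspace `H` has finite codimension in `H + β H`. -/
theorem finiteDimensional_quotient_of_finiteDimensional_range {K V : Type*} [Field K]
    [AddCommGroup V] [Module K V] (β : V →ₗ[K] V) (a : K)
    [FiniteDimensional K (LinearMap.range (β - a • 1))] (H : Submodule K V) :
    FiniteDimensional K (↥(H ⊔ H.map β) ⧸ H.comap (H ⊔ H.map β).subtype) := by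
  set L := H ⊔ H.map β
  set R := LinearMap.range (β - a • 1)
  have hle : L ≤ H ⊔ R := by
    refine sup_le le_sup_left ?_
    rintro _ ⟨x, hx, rfl⟩
    have hsplit : β x = a • x + (β - a • 1) x := by simp
    rw [hsplit]
    exact add_mem (mem_sup_left (H.smul_mem a hx)) (mem_sup_right ⟨x, rfl⟩)
  have hmem : ∀ q, (H.comap L.subtype).mapQ H L.subtype le_rfl q ∈ R.map H.mkQ := by
    intro q
    obtain ⟨⟨x, hx⟩, rfl⟩ := mkQ_surjective _ q
    obtain ⟨y, hy, z, hz, rfl⟩ := mem_sup.1 (hle hx)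
    exact ⟨z, hz, by simpa using hy⟩
  exact Module.Finite.of_injective (LinearMap.codRestrict _ _ hmem)
    ((LinearMap.injective_codRestrict_iff hmem).2 (mapQ_subtype_comap_injective H L))


/-- For an endomorphism `β` of an infinite-dimensional vector space `V`, every
subspace `H` has finite codimension in `H + β(H)` if and only if `β` acts as a
scalar multiplication on some subspace of finite codimension. -/
theorem stmt14 {K V : Type*} [Field K] [AddCommGroup V] [Module K V]
    (hV : ¬ FiniteDimensional K V) (β : V →ₗ[K] V) :
    (∀ H : Submodule K V,
        FiniteDimensional K
          (↥(H ⊔ Submodule.map β H) ⧸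
            Submodule.comap (H ⊔ Submodule.map β H).subtype H)) ↔
      ∃ (lam : K) (W : Submodule K V), FiniteDimensional K (V ⧸ W) ∧
        ∀ w ∈ W, β w = lam • w := by
  constructor
  · intro h
    obtain ⟨F, hF, hdep⟩ : ∃ F : Submodule K V, FiniteDimensional K F ∧
        ∀ x ∉ F, β x ∈ F ⊔ Submodule.span K {x} := by
      by_contra! hind
      obtain ⟨s, hs, hli⟩ := exists_infinite_linearIndependent_sumElim β hind
      exact not_finiteDimensional_quotient_of_linearIndependent_sumElim β hs hli (h _)
    obtain ⟨a, ha⟩ := exists_range_sub_smul_le_of_forall_mem_sup_span hV β F hdep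
    have hrange : FiniteDimensional K (LinearMap.range (β - a • 1)) :=
      Submodule.finiteDimensional_of_le ha
    refine ⟨a, LinearMap.ker (β - a • 1),
      Module.Finite.equiv (β - a • 1).quotKerEquivRange.symm, fun w hw => ?_⟩
    simpa [sub_eq_zero] using hw
  · rintro ⟨a, W, hW, hβ⟩ H
    have hker : W ≤ LinearMap.ker (β - a • 1) := fun w hw => by simp [hβ w hw]
    have hrange : FiniteDimensional K (LinearMap.range (β - a • 1)) := by
      rw [← W.range_liftQ _ hker]
      infer_instance
    exact finiteDimensional_quotient_of_finiteDimensional_range β a H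
end
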